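/- In the multi-server secure aggregation model, assume only the structural and correctness constraints (the security constraint is not needed). Then for every server u ∈ [U] and every v ∈ [V_u], H(Y_u | {W_{i,j}, Z_{i,j}}_{(i,j)∈𝒦∖{(u,v)}}) ≥ L. -/

import Mathlib

open Finset

open scoped Classical

noncomputable section

/-- Probability that the random variable `X` takes the value `s`, under the weights `μ`. -/
def prb {Ω : Type} [Fintype Ω] (μ : Ω → ℝ) {α : Type} (X : Ω → α) (s : α) : ℝ :=
  ∑ ω ∈ Finset.univ.filter fun ω => X ω = s, μ ω

/-- Shannon entropy of `X` in `q`-ary units. -/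
def ent (q : ℕ) {Ω : Type} [Fintype Ω] (μ : Ω → ℝ) {α : Type} [Fintype α] (X : Ω → α) : ℝ :=
  -∑ s : α, prb μ X s * Real.logb q (prb μ X s)

/-- Conditional entropy `H(X | Y)` in `q`-ary units. -/
def condEnt (q : ℕ) {Ω : Type} [Fintype Ω] (μ : Ω → ℝ) {α β : Type} [Fintype α] [Fintype β]
    (X : Ω → α) (Y : Ω → β) : ℝ :=
  ent q μ (fun ω => (X ω, Y ω)) - ent q μ Y

/-- Conditional mutual information `I(X ; Y ∣ Z)` in `q`-ary units. -/
def mutInfo (q : ℕ) {Ω : Type} [Fintype Ω] (μ : Ω → ℝ) {α β γ : Type}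
    [Fintype α] [Fintype β] [Fintype γ] (X : Ω → α) (Y : Ω → β) (Z : Ω → γ) : ℝ :=
  condEnt q μ X Z - condEnt q μ X fun ω => (Y ω, Z ω)

/-- The joint random variable formed by the members of a family of random variables
indexed by a finset. -/
def restr {Ω ι α : Type} (Z : ι → Ω → α) (T : Finset ι) : Ω → { i // i ∈ T } → α :=
  fun ω i => Z i.1 ω

/-- The set of users `𝒦`: user `⟨u,v⟩` is the `v`-th user of server `u`. -/
abbrev Usr (U : ℕ) (V : Fin U → ℕ) : Type := Σ u : Fin U, Fin (V u)

/-- Total number of users, `K = ∑ u, V u`. -/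
def Ktot (U : ℕ) (V : Fin U → ℕ) : ℕ := ∑ u, V u

/-- The users connected to server `u`, `𝒦_{{u}}`. -/
def Ksrv (U : ℕ) (V : Fin U → ℕ) (u : Fin U) : Finset (Usr U V) :=
  Finset.univ.filter fun i => i.1 = u

/-- The users connected to a set of servers, `𝒦_𝒰`. -/
def KsrvSet (U : ℕ) (V : Fin U → ℕ) (A : Finset (Fin U)) : Finset (Usr U V) :=
  Finset.univ.filter fun i => i.1 ∈ A

/-- The set of servers `𝒰^{(m,n)}` associated with a security input set `Sm` and a
colluding set `Tn`. -/
def UServers (U : ℕ) (V : Fin U → ℕ) (Sm Tn : Finset (Usr U V)) : Finset (Fin U) :=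
  Finset.univ.filter fun u =>
    (Sm ∩ Ksrv U V u).Nonempty ∧ ((Sm ∪ Tn) ∩ Ksrv U V u).card = V u

/-- The set `(𝒮_m ∩ 𝒦_{{u}}) ∪ 𝒦_{𝒰^{(m,n)}} ∪ 𝒯_n`. -/
def BigB (U : ℕ) (V : Fin U → ℕ) (Sm Tn : Finset (Usr U V)) (u : Fin U) : Finset (Usr U V) :=
  (Sm ∩ Ksrv U V u) ∪ KsrvSet U V (UServers U V Sm Tn) ∪ Tn

/-- The implicit security input set `𝒮_I`. -/
def SImp (U : ℕ) (V : Fin U → ℕ) {M N : ℕ} (S : Fin M → Finset (Usr U V))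
    (T : Fin N → Finset (Usr U V)) : Finset (Usr U V) :=
  Finset.univ.filter fun i =>
    (∀ m, i ∉ S m) ∧
    ∃ u m n, (BigB U V (S m) (T n) u).card = Ktot U V - 1 ∧ i ∉ BigB U V (S m) (T n) u

/-- The total security input set `𝒮̄`. -/
def Sbar (U : ℕ) (V : Fin U → ℕ) {M N : ℕ} (S : Fin M → Finset (Usr U V))
    (T : Fin N → Finset (Usr U V)) : Finset (Usr U V) :=
  (Finset.univ.biUnion fun m => S m) ∪ SImp U V S T

/-- The set `𝒜_{u,m,n}`. -/
def Aset (U : ℕ) (V : Fin U → ℕ) {M N : ℕ} (S : Fin M → Finset (Usr U V))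
    (T : Fin N → Finset (Usr U V)) (u : Fin U) (m : Fin M) (n : Fin N) : Finset (Usr U V) :=
  BigB U V (S m) (T n) u ∩ Sbar U V S T

/-- `a* = max_{u,m,n} |𝒜_{u,m,n}|`. -/
def aStar (U : ℕ) (V : Fin U → ℕ) {M N : ℕ} (S : Fin M → Finset (Usr U V))
    (T : Fin N → Finset (Usr U V)) : ℕ :=
  Finset.univ.sup fun t : Fin U × Fin M × Fin N => (Aset U V S T t.1 t.2.1 t.2.2).card

/-- `|((𝒮_m ∩ 𝒦_{{u}}) ∪ 𝒯_n) ∩ 𝒮̄| + |𝒰^{(m,n)} ∖ {u}|`. -/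
def eVal (U : ℕ) (V : Fin U → ℕ) {M N : ℕ} (S : Fin M → Finset (Usr U V))
    (T : Fin N → Finset (Usr U V)) (u : Fin U) (m : Fin M) (n : Fin N) : ℕ :=
  (((S m ∩ Ksrv U V u) ∪ T n) ∩ Sbar U V S T).card + ((UServers U V (S m) (T n)).erase u).card

/-- `e* = max_{u,m,n} (|((𝒮_m ∩ 𝒦_{{u}}) ∪ 𝒯_n) ∩ 𝒮̄| + |𝒰^{(m,n)} ∖ {u}|)`. -/
def eStar (U : ℕ) (V : Fin U → ℕ) {M N : ℕ} (S : Fin M → Finset (Usr U V))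
    (T : Fin N → Finset (Usr U V)) : ℕ :=
  Finset.univ.sup fun t : Fin U × Fin M × Fin N => eVal U V S T t.1 t.2.1 t.2.2

/-- The set `𝒬_1`. -/
def Q1set (U : ℕ) (V : Fin U → ℕ) {M N : ℕ} (S : Fin M → Finset (Usr U V))
    (T : Fin N → Finset (Usr U V)) : Finset (Usr U V) :=
  (Finset.univ.filter fun t : Fin U × Fin M × Fin N =>
      (Aset U V S T t.1 t.2.1 t.2.2).card = (Sbar U V S T).card).biUnion
    fun t => BigB U V (S t.2.1) (T t.2.2) t.1

/-- The set `𝒬_2`. -/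
def Q2set (U : ℕ) (V : Fin U → ℕ) {M N : ℕ} (S : Fin M → Finset (Usr U V))
    (T : Fin N → Finset (Usr U V)) : Finset (Usr U V) :=
  (Finset.univ.filter fun t : Fin U × Fin M × Fin N =>
      eVal U V S T t.1 t.2.1 t.2.2 = eStar U V S T).biUnion
    fun t => BigB U V (S t.2.1) (T t.2.2) t.1

/-- The set `𝒬`. -/
def Qset (U : ℕ) (V : Fin U → ℕ) {M N : ℕ} (S : Fin M → Finset (Usr U V))
    (T : Fin N → Finset (Usr U V)) : Finset (Usr U V) :=
  if (Q1set U V S T).Nonempty then Q1set U V S T ∪ Q2set U V S T else ∅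

/-- A secure-aggregation scheme: all structural, distributional, correctness and
security constraints of the multi-server secure aggregation model, with entropies in
`q`-ary units for `q = |F|`. -/
def IsScheme (U : ℕ) (V : Fin U → ℕ) (M N : ℕ) (S : Fin M → Finset (Usr U V))
    (T : Fin N → Finset (Usr U V)) (F : Type) [Field F] [Fintype F]
    (Ω : Type) [Fintype Ω] (μ : Ω → ℝ) (L LX LY LZ LSig : ℕ)
    (W : Usr U V → Ω → Fin L → F) (Z : Usr U V → Ω → Fin LZ → F)
    (X : Usr U V → Ω → Fin LX → F) (Y : Fin U → Ω → Fin LY → F)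
    (ZS : Ω → Fin LSig → F) : Prop :=
  let q := Fintype.card F
  (1 ≤ L) ∧
  (∀ ω, 0 ≤ μ ω) ∧ (∑ ω, μ ω = 1) ∧
  -- each input consists of `L` i.i.d. uniform `q`-ary symbols
  (∀ i, ent q μ (W i) = L) ∧
  -- the inputs are mutually independent of each other and of all keys
  (ent q μ (fun ω => (restr W Finset.univ ω, restr Z Finset.univ ω)) =
    ent q μ (restr Z Finset.univ) + ∑ i, ent q μ (W i)) ∧
  -- the source key consists of `LSig` i.i.d. uniform `q`-ary symbols
  (ent q μ ZS = LSig) ∧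
  -- the individual keys are deterministic functions of the source key
  (condEnt q μ (restr Z Finset.univ) ZS = 0) ∧
  -- each user message is a deterministic function of its input and key
  (∀ i, condEnt q μ (X i) (fun ω => (W i ω, Z i ω)) = 0) ∧
  -- each server message is a deterministic function of its received messages
  (∀ u, condEnt q μ (Y u) (restr X (Ksrv U V u)) = 0) ∧
  -- correctness
  (∀ k, condEnt q μ (fun ω => ∑ i, W i ω)
    (fun ω => (restr Y (Finset.univ.erase k) ω, restr X (Ksrv U V k) ω)) = 0) ∧
  -- security
  (∀ k m n, mutInfo q μ
    (fun ω => (restr Y (Finset.univ.erase k) ω, restr X (Ksrv U V k) ω))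
    (restr W (S m))
    (fun ω => (∑ i, W i ω, restr W (T n) ω, restr Z (T n) ω)) = 0)

/-- A rate tuple `(R_X, R_Y, R_{Z_Σ})` is achievable. -/
def Achievable (U : ℕ) (V : Fin U → ℕ) (M N : ℕ) (S : Fin M → Finset (Usr U V))
    (T : Fin N → Finset (Usr U V)) (R : ℝ × ℝ × ℝ) : Prop :=
  ∃ (F : Type) (iF : Field F) (iFt : Fintype F) (Ω : Type) (iΩ : Fintype Ω)
    (μ : Ω → ℝ) (L LX LY LZ LSig : ℕ)
    (W : Usr U V → Ω → Fin L → F) (Z : Usr U V → Ω → Fin LZ → F)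
    (X : Usr U V → Ω → Fin LX → F) (Y : Fin U → Ω → Fin LY → F)
    (ZS : Ω → Fin LSig → F),
    R.1 = (LX : ℝ) / (L : ℝ) ∧ R.2.1 = (LY : ℝ) / (L : ℝ) ∧ R.2.2 = (LSig : ℝ) / (L : ℝ) ∧
    @IsScheme U V M N S T F iF iFt Ω iΩ μ L LX LY LZ LSig W Z X Y ZS

end

section EntropyLemmas

lemma restr_eq_iff {Ω ι α : Type} {Z : ι → Ω → α} {T : Finset ι} {ω ω' : Ω} :
    restr Z T ω = restr Z T ω' ↔ ∀ i ∈ T, Z i ω = Z i ω' :=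
  ⟨fun h i hi => congrFun h ⟨i, hi⟩, fun h => funext fun i => h i.1 i.2⟩

variable {Ω : Type} [Fintype Ω] {μ : Ω → ℝ} {q : ℕ} {α β γ : Type}

lemma prb_nonneg (hμ0 : ∀ ω, 0 ≤ μ ω) (X : Ω → α) (s : α) : 0 ≤ prb μ X s :=
  Finset.sum_nonneg fun ω _ => hμ0 ω

lemma prb_self_pos (hμ0 : ∀ ω, 0 ≤ μ ω) (X : Ω → α) {ω : Ω} (hω : 0 < μ ω) :
    0 < prb μ X (X ω) :=
  hω.trans_le (Finset.single_le_sum (f := μ) (fun ω _ => hμ0 ω) (by simp))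

lemma sum_prb_mul [Fintype α] (X : Ω → α) (f : α → ℝ) :
    ∑ s, prb μ X s * f s = ∑ ω, μ ω * f (X ω) := by
  rw [← Finset.sum_fiberwise Finset.univ X]
  refine Finset.sum_congr rfl fun s _ => ?_
  rw [prb, Finset.sum_mul]
  refine Finset.sum_congr rfl fun ω hω => ?_
  rw [(Finset.mem_filter.1 hω).2]

lemma ent_eq_neg_sum [Fintype α] (X : Ω → α) :
    ent q μ X = -∑ ω, μ ω * Real.logb q (prb μ X (X ω)) := by
  rw [ent, sum_prb_mul X fun s => Real.logb q (prb μ X s)]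

lemma sum_prb_pair [Fintype α] (X : Ω → α) (Y : Ω → β) (y : β) :
    ∑ x, prb μ (fun ω => (X ω, Y ω)) (x, y) = prb μ Y y := by
  simp only [prb, Prod.mk.injEq]
  rw [← Finset.sum_fiberwise (Finset.univ.filter fun ω => Y ω = y) X]
  refine Finset.sum_congr rfl fun x _ => ?_
  rw [Finset.filter_filter]
  simp only [and_comm]

/-- `Y` determines `X` on the support of `μ`. -/
def DeterminesOn (μ : Ω → ℝ) (Y : Ω → β) (X : Ω → α) : Prop :=
  ∀ ω ω', 0 < μ ω → 0 < μ ω' → Y ω = Y ω' → X ω = X ω'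

lemma prb_self_le_of_determinesOn (hμ0 : ∀ ω, 0 ≤ μ ω) {Y : Ω → β} {X : Ω → α}
    (h : DeterminesOn μ Y X) {ω : Ω} (hω : 0 < μ ω) :
    prb μ Y (Y ω) ≤ prb μ X (X ω) := by
  unfold prb
  rw [Finset.sum_filter, Finset.sum_filter]
  refine Finset.sum_le_sum fun ω' _ => ?_
  rcases (hμ0 ω').eq_or_lt with h0 | h0
  · simp [← h0]
  · by_cases hY : Y ω' = Y ω
    · simp [hY, h ω' ω h0 hω hY]
    · simp only [hY, if_false]
      split_ifs
      exacts [h0.le, le_rfl]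

lemma ent_le_of_determinesOn [Fintype α] [Fintype β] (hq : 1 < q) (hμ0 : ∀ ω, 0 ≤ μ ω)
    {Y : Ω → β} {X : Ω → α} (h : DeterminesOn μ Y X) : ent q μ X ≤ ent q μ Y := by
  rw [ent_eq_neg_sum, ent_eq_neg_sum, neg_le_neg_iff]
  refine Finset.sum_le_sum fun ω _ => ?_
  rcases (hμ0 ω).eq_or_lt with h0 | h0
  · simp [← h0]
  · exact mul_le_mul_of_nonneg_left (Real.logb_le_logb_of_le (by exact_mod_cast hq)
      (prb_self_pos hμ0 Y h0) (prb_self_le_of_determinesOn hμ0 h h0)) h0.le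

lemma determinesOn_of_condEnt_eq_zero [Fintype α] [Fintype β] (hq : 1 < q)
    (hμ0 : ∀ ω, 0 ≤ μ ω) {Y : Ω → β} {X : Ω → α} (h : condEnt q μ X Y = 0) :
    DeterminesOn μ Y X := by
  have hq' : (1 : ℝ) < q := by exact_mod_cast hq
  have hle : ∀ ω, 0 < μ ω → prb μ (fun ω => (X ω, Y ω)) (X ω, Y ω) ≤ prb μ Y (Y ω) :=
    fun ω hω => prb_self_le_of_determinesOn hμ0 (Y := fun ω => (X ω, Y ω))
      (fun _ _ _ _ he => congrArg Prod.snd he) hω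
  have hterm : ∀ ω ∈ Finset.univ, μ ω * Real.logb q (prb μ (fun ω => (X ω, Y ω)) (X ω, Y ω))
      ≤ μ ω * Real.logb q (prb μ Y (Y ω)) := fun ω _ => by
    rcases (hμ0 ω).eq_or_lt with h0 | h0
    · simp [← h0]
    · exact mul_le_mul_of_nonneg_left (Real.logb_le_logb_of_le hq'
        (prb_self_pos hμ0 (fun ω => (X ω, Y ω)) h0) (hle ω h0)) h0.le
  rw [condEnt, ent_eq_neg_sum, ent_eq_neg_sum] at h
  have heq := (Finset.sum_eq_sum_iff_of_le hterm).1 (by linarith)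
  intro ω ω' hω hω' hY
  by_contra hne
  have hprb : prb μ (fun ω => (X ω, Y ω)) (X ω, Y ω) = prb μ Y (Y ω) :=
    Real.logb_injOn_pos hq' (prb_self_pos hμ0 (fun ω => (X ω, Y ω)) hω)
      (prb_self_pos hμ0 Y hω) (mul_left_cancel₀ hω.ne' (heq ω (Finset.mem_univ ω)))
  refine hprb.not_lt ?_
  refine Finset.sum_lt_sum_of_subset (i := ω') (fun a ha => ?_) ?_ ?_ hω' fun a _ _ => hμ0 a
  · simp only [Finset.mem_filter, Prod.mk.injEq] at ha ⊢
    exact ⟨ha.1, ha.2.2⟩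
  · simp [hY]
  · simp [Ne.symm hne]

/-- Submodularity of Shannon entropy. -/
lemma ent_triple_add_le [Fintype α] [Fintype β] [Fintype γ] (hq : 1 < q)
    (hμ0 : ∀ ω, 0 ≤ μ ω) (X : Ω → α) (Y : Ω → β) (Z : Ω → γ) :
    ent q μ (fun ω => (X ω, Y ω, Z ω)) + ent q μ Z ≤
      ent q μ (fun ω => (X ω, Z ω)) + ent q μ (fun ω => (Y ω, Z ω)) := by
  have hlog : 0 < Real.log q := Real.log_pos (by exact_mod_cast hq)
  set T : Ω → α × β × γ := fun ω => (X ω, Y ω, Z ω)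
  set A : Ω → α × γ := fun ω => (X ω, Z ω)
  set B : Ω → β × γ := fun ω => (Y ω, Z ω)
  let f : α × β × γ → ℝ := fun t =>
    prb μ A (t.1, t.2.2) * prb μ B t.2 / (prb μ T t * prb μ Z t.2.2)
  have hterm : ∀ ω, μ ω * (Real.logb q (prb μ A (A ω)) + Real.logb q (prb μ B (B ω))
      - Real.logb q (prb μ T (T ω)) - Real.logb q (prb μ Z (Z ω))) ≤
      μ ω * ((f (T ω) - 1) / Real.log q) := fun ω => by
    rcases (hμ0 ω).eq_or_lt with h0 | h0
    · simp [← h0]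
    refine mul_le_mul_of_nonneg_left ?_ h0.le
    have hpA := prb_self_pos hμ0 A h0
    have hpB := prb_self_pos hμ0 B h0
    have hpT := prb_self_pos hμ0 T h0
    have hpZ := prb_self_pos hμ0 Z h0
    have key := Real.log_le_sub_one_of_pos
      (div_pos (mul_pos hpA hpB) (mul_pos hpT hpZ))
    rw [Real.log_div (mul_pos hpA hpB).ne' (mul_pos hpT hpZ).ne',
      Real.log_mul hpA.ne' hpB.ne', Real.log_mul hpT.ne' hpZ.ne'] at key
    simp only [Real.logb, ← add_div, ← sub_div]
    refine div_le_div_of_nonneg_right ?_ hlog.le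
    have hf : f (T ω) = prb μ A (A ω) * prb μ B (B ω) / (prb μ T (T ω) * prb μ Z (Z ω)) := rfl
    rw [hf]
    linarith
  have hsum : ∑ ω, μ ω * f (T ω) ≤ ∑ ω, μ ω := by
    rw [← sum_prb_mul T f]
    calc ∑ t, prb μ T t * f t
        ≤ ∑ t : α × β × γ, prb μ A (t.1, t.2.2) * (prb μ B t.2 / prb μ Z t.2.2) := by
          refine Finset.sum_le_sum fun t _ => ?_
          rcases (prb_nonneg hμ0 T t).eq_or_lt with h0 | h0
          · rw [← h0, zero_mul]
            exact mul_nonneg (prb_nonneg hμ0 _ _)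
              (div_nonneg (prb_nonneg hμ0 _ _) (prb_nonneg hμ0 _ _))
          · refine le_of_eq ?_
            simp only [f]
            rw [← mul_div_assoc, mul_div_mul_left _ _ h0.ne', mul_div_assoc]
      _ = ∑ b : β × γ, prb μ B b * (prb μ Z b.2 / prb μ Z b.2) := by
          rw [Fintype.sum_prod_type_right]
          refine Finset.sum_congr rfl fun b _ => ?_
          change ∑ x, prb μ A (x, b.2) * (prb μ B b / prb μ Z b.2) = _
          rw [← Finset.sum_mul, sum_prb_pair X Z b.2]
          ring
      _ = ∑ ω, μ ω * (prb μ Z (Z ω) / prb μ Z (Z ω)) :=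
          sum_prb_mul B fun b => prb μ Z b.2 / prb μ Z b.2
      _ ≤ ∑ ω, μ ω := Finset.sum_le_sum fun ω _ =>
          mul_le_of_le_one_right (hμ0 ω) (div_self_le_one _)
  have hall := Finset.sum_le_sum fun ω (_ : ω ∈ Finset.univ) => hterm ω
  have hrhs : ∑ ω, μ ω * ((f (T ω) - 1) / Real.log q) ≤ 0 := by
    have : ∑ ω, μ ω * ((f (T ω) - 1) / Real.log q) =
        (∑ ω, μ ω * f (T ω) - ∑ ω, μ ω) / Real.log q := by
      rw [← Finset.sum_sub_distrib, Finset.sum_div]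
      exact Finset.sum_congr rfl fun ω _ => by ring
    rw [this]
    exact div_nonpos_of_nonpos_of_nonneg (by linarith) hlog.le
  simp only [mul_sub, mul_add, Finset.sum_sub_distrib, Finset.sum_add_distrib] at hall
  simp only [ent_eq_neg_sum]
  linarith

/-- Subadditivity of Shannon entropy. -/
lemma ent_pair_le_add [Fintype α] [Fintype β] (hq : 1 < q)
    (hμ0 : ∀ ω, 0 ≤ μ ω) (hμ1 : ∑ ω, μ ω = 1) (X : Ω → α) (Y : Ω → β) :
    ent q μ (fun ω => (X ω, Y ω)) ≤ ent q μ X + ent q μ Y := by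
  have h := ent_triple_add_le hq hμ0 X Y fun _ => ()
  have hU : ent q μ (fun _ : Ω => ()) = 0 := by simp [ent, prb, hμ1]
  have hXY : ent q μ (fun ω => (X ω, Y ω)) ≤ ent q μ (fun ω => (X ω, Y ω, ())) :=
    ent_le_of_determinesOn hq hμ0 fun _ _ _ _ he => by simpa using he
  have hX : ent q μ (fun ω => (X ω, ())) ≤ ent q μ X :=
    ent_le_of_determinesOn hq hμ0 fun _ _ _ _ he => by simpa using he
  have hY : ent q μ (fun ω => (Y ω, ())) ≤ ent q μ Y :=
    ent_le_of_determinesOn hq hμ0 fun _ _ _ _ he => by simpa using he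
  linarith

lemma ent_restr_pair_le {ι : Type} [DecidableEq ι] [Fintype α] [Fintype β] (hq : 1 < q)
    (hμ0 : ∀ ω, 0 ≤ μ ω) (hμ1 : ∑ ω, μ ω = 1) (W : ι → Ω → α) (B : Ω → β) (T : Finset ι) :
    ent q μ (fun ω => (restr W T ω, B ω)) ≤ ∑ i ∈ T, ent q μ (W i) + ent q μ B := by
  induction T using Finset.induction_on with
  | empty =>
    rw [Finset.sum_empty, zero_add]
    refine ent_le_of_determinesOn hq hμ0 fun _ _ _ _ he => ?_
    simp [he, restr_eq_iff]
  | insert a T ha ih =>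
    have h1 : ent q μ (fun ω => (restr W (insert a T) ω, B ω)) ≤
        ent q μ (fun ω => (W a ω, restr W T ω, B ω)) :=
      ent_le_of_determinesOn hq hμ0 fun _ _ _ _ he => by
        simpa [restr_eq_iff, and_assoc] using he
    have h2 := ent_pair_le_add hq hμ0 hμ1 (W a) fun ω => (restr W T ω, B ω)
    rw [Finset.sum_insert ha]
    linarith

end EntropyLemmas

theorem stmt5_server_message_entropy
    (U : ℕ) (hU : 3 ≤ U) (V : Fin U → ℕ) (hV : ∀ u, 1 ≤ V u)
    (F : Type) [Field F] [Fintype F] (Ω : Type) [Fintype Ω] (μ : Ω → ℝ)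
    (hμ0 : ∀ ω, 0 ≤ μ ω) (hμ1 : ∑ ω, μ ω = 1)
    (L LX LY LZ : ℕ) (hL : 1 ≤ L)
    (W : Usr U V → Ω → Fin L → F) (Z : Usr U V → Ω → Fin LZ → F)
    (X : Usr U V → Ω → Fin LX → F) (Y : Fin U → Ω → Fin LY → F)
    (hWent : ∀ i, ent (Fintype.card F) μ (W i) = L)
    (hInd : ent (Fintype.card F) μ (fun ω => (restr W Finset.univ ω, restr Z Finset.univ ω)) =
      ent (Fintype.card F) μ (restr Z Finset.univ) + ∑ i, ent (Fintype.card F) μ (W i))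
    (hX : ∀ i, condEnt (Fintype.card F) μ (X i) (fun ω => (W i ω, Z i ω)) = 0)
    (hY : ∀ u, condEnt (Fintype.card F) μ (Y u) (restr X (Ksrv U V u)) = 0)
    (hCorr : ∀ k, condEnt (Fintype.card F) μ (fun ω => ∑ i, W i ω)
      (fun ω => (restr Y (Finset.univ.erase k) ω, restr X (Ksrv U V k) ω)) = 0) :
    ∀ (u : Fin U) (v : Fin (V u)), (L : ℝ) ≤ condEnt (Fintype.card F) μ (Y u)
      (fun ω => (restr W (Finset.univ.erase ⟨u, v⟩) ω, restr Z (Finset.univ.erase ⟨u, v⟩) ω)) := by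
  intro u v
  have hq : 1 < Fintype.card F := Fintype.one_lt_card
  set e : Usr U V := ⟨u, v⟩
  set A := fun ω => (restr W (Finset.univ.erase e) ω, restr Z (Finset.univ.erase e) ω) with hA
  have : Nontrivial (Fin U) := Fin.nontrivial_iff_two_le.2 (by omega)
  obtain ⟨k, hk⟩ := exists_ne u
  have hdet : DeterminesOn μ (fun ω => (Y u ω, A ω)) (fun ω => (W e ω, A ω)) := by
    intro ω ω' hω hω' h
    obtain ⟨hYu, hAeq⟩ := Prod.mk.inj h
    obtain ⟨hWr, hZr⟩ := Prod.mk.inj hAeq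
    rw [restr_eq_iff] at hWr hZr
    have hXeq : ∀ i, i ≠ e → X i ω = X i ω' := fun i hi =>
      determinesOn_of_condEnt_eq_zero hq hμ0 (hX i) ω ω' hω hω'
        (Prod.ext (hWr i (by simpa using hi)) (hZr i (by simpa using hi)))
    have hXsrv : ∀ j, j ≠ u → restr X (Ksrv U V j) ω = restr X (Ksrv U V j) ω' := fun j hj =>
      restr_eq_iff.2 fun i hi => hXeq i fun hie => hj (by
        rw [Ksrv, Finset.mem_filter] at hi
        rw [← hi.2, hie])
    have hYeq : ∀ j, Y j ω = Y j ω' := fun j => by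
      by_cases hj : j = u
      · rw [hj, hYu]
      · exact determinesOn_of_condEnt_eq_zero hq hμ0 (hY j) ω ω' hω hω' (hXsrv j hj)
    have hsum := determinesOn_of_condEnt_eq_zero hq hμ0 (hCorr k) ω ω' hω hω'
      (Prod.ext (restr_eq_iff.2 fun j _ => hYeq j) (hXsrv k hk))
    rw [← Finset.add_sum_erase _ _ (Finset.mem_univ e),
      ← Finset.add_sum_erase _ (fun i => W i ω') (Finset.mem_univ e),
      Finset.sum_congr rfl hWr] at hsum
    exact Prod.ext (add_right_cancel hsum) hAeq
  have h1 := ent_le_of_determinesOn hq hμ0 hdet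
  have h2 := ent_triple_add_le hq hμ0 (W e) (Z e) A
  have h3 : ent (Fintype.card F) μ (fun ω => (restr W Finset.univ ω, restr Z Finset.univ ω)) ≤
      ent (Fintype.card F) μ (fun ω => (W e ω, Z e ω, A ω)) :=
    ent_le_of_determinesOn hq hμ0 fun ω ω' _ _ h => by
      simp only [hA, Prod.mk.injEq, restr_eq_iff, Finset.mem_erase, Finset.mem_univ,
        and_true, true_implies] at h ⊢
      obtain ⟨hW, hZ, hWr, hZr⟩ := h
      refine ⟨fun i => ?_, fun i => ?_⟩ <;> rcases eq_or_ne i e with rfl | hi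
      exacts [hW, hWr i hi, hZ, hZr i hi]
  have h4 : ent (Fintype.card F) μ (fun ω => (Z e ω, A ω)) ≤ ent (Fintype.card F) μ
      (fun ω => (restr W (Finset.univ.erase e) ω, restr Z Finset.univ ω)) :=
    ent_le_of_determinesOn hq hμ0 fun ω ω' _ _ h => by
      simp only [hA, Prod.mk.injEq, restr_eq_iff, Finset.mem_univ, true_implies] at h ⊢
      exact ⟨h.2 e, h.1, fun i _ => h.2 i⟩
  have h5 := ent_restr_pair_le hq hμ0 hμ1 W (restr Z Finset.univ) (Finset.univ.erase e)
  have h6 := Finset.add_sum_erase Finset.univ (fun i => ent (Fintype.card F) μ (W i))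
    (Finset.mem_univ e)
  have h7 := hWent e
  simp only [condEnt] at h6 ⊢
  linarith
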